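/- Let N ≥ 2 be an integer, Ω ⊂ ℝ^N a bounded open set, δ > 0, and let χ : ℝ^N → [0,1] be a smooth function with compact support contained in Ω and χ = 1 on {x ∈ Ω : dist(x, ℝ^N∖Ω) > δ/2}; set K = {x ∈ Ω : dist(x, ℝ^N∖Ω) ≥ δ} and assume K ≠ ∅. Let C_0 ≥ 1 and V : ℝ^N → ℝ be Lipschitz with constant C_0 and satisfy 1/C_0 ≤ V(x) ≤ C_0 on the closure of Ω. Fix an integer m ≥ 1 and λ > c_N m. For points p_1, …, p_m ∈ K, weights t_1, …, t_m ≥ 0 with Σ t_i = 1, and ε > 0, define φ_{ε,σ}(x) = χ(x) log Σ_{i=1}^{m} t_i F_N / ( (ε^{N/(N−1)} + |x−p_i|^{N/(N−1)})^N V(p_i) ), where F_N = N (N²/(N−1))^{N−1}. Then for every M > 0 there exists ε_1 > 0 such that (1/N) ∫_Ω |∇φ_{ε,σ}|^N dx − λ log( ∫_Ω V e^{φ_{ε,σ}} dx ) ≤ −M for all ε ∈ (0, ε_1], all p_1,…,p_m ∈ K and all weights t_1,…,t_m as above. -/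

import Mathlib

open MeasureTheory Real Metric Set
open scoped ENNReal

noncomputable def omegaN (N : ℕ) : ℝ :=
  (volume (Metric.ball (0 : EuclideanSpace ℝ (Fin N)) 1)).toReal

noncomputable def cN (N : ℕ) : ℝ :=
  N * ((N : ℝ) ^ 2 / ((N : ℝ) - 1)) ^ (N - 1) * omegaN N

noncomputable def FN (N : ℕ) : ℝ :=
  N * ((N : ℝ) ^ 2 / ((N : ℝ) - 1)) ^ (N - 1)

/-- The test function `φ_{ε,σ}` associated to the formal barycenter
`σ = Σ tᵢ δ_{pᵢ}`, built from the standard bubbles and localized by `χ`. -/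
noncomputable def testFun (N m : ℕ) (χ V : EuclideanSpace ℝ (Fin N) → ℝ)
    (p : Fin m → EuclideanSpace ℝ (Fin N)) (t : Fin m → ℝ) (ε : ℝ)
    (x : EuclideanSpace ℝ (Fin N)) : ℝ :=
  χ x * Real.log (∑ i, t i * (FN N /
    ((ε ^ ((N : ℝ) / ((N : ℝ) - 1)) + ‖x - p i‖ ^ ((N : ℝ) / ((N : ℝ) - 1))) ^ N * V (p i))))

/-- A standard bubble centred at `p` with scale `ε`, with free normalization constants. -/
noncomputable def bubble {E : Type*} [NormedAddCommGroup E] (N : ℕ) (F ε v : ℝ) (p x : E) : ℝ :=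
  F / ((ε ^ ((N : ℝ) / ((N : ℝ) - 1)) + ‖x - p‖ ^ ((N : ℝ) / ((N : ℝ) - 1))) ^ N * v)

lemma rpow_sub_one_le_div_max {a r ε : ℝ} (ha : 1 < a) (hr : 0 ≤ r) (hε : 0 < ε) :
    r ^ (a - 1) ≤ (ε ^ a + r ^ a) / max r ε := by
  have hm : 0 < max r ε := lt_max_of_lt_right hε
  have hmax : max r ε ^ a ≤ ε ^ a + r ^ a := by
    rcases max_cases r ε with ⟨h, -⟩ | ⟨h, -⟩ <;> rw [h]
    · linarith [rpow_nonneg hε.le a]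
    · linarith [rpow_nonneg hr a]
  rw [le_div_iff₀ hm]
  calc r ^ (a - 1) * max r ε ≤ max r ε ^ (a - 1) * max r ε := by
        have : 0 ≤ a - 1 := by linarith
        gcongr
        exact le_max_left _ _
    _ = max r ε ^ a := by rw [← rpow_add_one hm.ne']; ring_nf
    _ ≤ _ := hmax

lemma one_lt_div_sub_one {N : ℕ} (hN : 2 ≤ N) : 1 < (N : ℝ) / ((N : ℝ) - 1) := by
  have h : (2 : ℝ) ≤ N := by exact_mod_cast hN
  rw [lt_div_iff₀ (by linarith)]
  linarith

lemma bubble_pos {E : Type*} [NormedAddCommGroup E] (N : ℕ) {F ε v : ℝ} (hF : 0 < F)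
    (hε : 0 < ε) (hv : 0 < v) (p x : E) : 0 < bubble N F ε v p x := by
  unfold bubble; positivity

lemma exists_hasFDerivAt_bubble {E : Type*} [NormedAddCommGroup E] [InnerProductSpace ℝ E]
    {N : ℕ} (hN : 2 ≤ N) {F ε v : ℝ} (hF : 0 < F) (hε : 0 < ε) (hv : 0 < v) (p x : E) :
    ∃ L : E →L[ℝ] ℝ, HasFDerivAt (bubble N F ε v p) L x ∧
      ‖L‖ ≤ (N : ℝ) ^ 2 / ((N : ℝ) - 1) / max ‖x - p‖ ε * bubble N F ε v p x := by
  have ha := one_lt_div_sub_one hN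
  have hN1 : (0 : ℝ) < (N : ℝ) - 1 := by
    have h : (2 : ℝ) ≤ N := by exact_mod_cast hN
    linarith
  have hNa : (N : ℝ) ^ 2 / ((N : ℝ) - 1) = N * ((N : ℝ) / ((N : ℝ) - 1)) := by ring
  have hm : 0 < max ‖x - p‖ ε := lt_max_of_lt_right hε
  unfold bubble
  rw [hNa]
  set a : ℝ := (N : ℝ) / ((N : ℝ) - 1) with ha_def
  have hdiff : Differentiable ℝ (fun y : E ↦ y - p) := differentiable_id.sub_const p
  have hr : DifferentiableAt ℝ (fun y : E ↦ ‖y - p‖ ^ a) x := (hdiff.norm_rpow ha) x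
  have hrn : ‖fderiv ℝ (fun y : E ↦ ‖y - p‖ ^ a) x‖ ≤ a * ‖x - p‖ ^ (a - 1) := by
    refine (norm_fderiv_norm_rpow_le hdiff ha).trans ?_
    have : ‖fderiv ℝ (fun y : E ↦ y - p) x‖ ≤ 1 := by
      rw [fderiv_sub_const]
      simpa using ContinuousLinearMap.norm_id_le (𝕜 := ℝ) (E := E)
    exact mul_le_of_le_one_right (by positivity) this
  set g : ℝ := ε ^ a + ‖x - p‖ ^ a with hg
  have hgpos : 0 < g := by positivity
  have hscalar : HasDerivAt (fun s : ℝ ↦ F / ((ε ^ a + s) ^ N * v))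
      (-(N / g) * (F / (g ^ N * v))) (‖x - p‖ ^ a) := by
    have h1 : HasDerivAt (fun s : ℝ ↦ (ε ^ a + s) ^ N * v)
        (N * g ^ (N - 1) * 1 * v) (‖x - p‖ ^ a) :=
      (((hasDerivAt_id _).const_add (ε ^ a)).pow N).mul_const v
    have h2 := (hasDerivAt_const (‖x - p‖ ^ a) F).div h1 (by positivity)
    refine h2.congr_deriv ?_
    obtain ⟨k, rfl⟩ : ∃ k, N = k + 1 := ⟨N - 1, by omega⟩
    rw [← hg]
    simp only [Nat.add_sub_cancel]
    field_simp
    ring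
  refine ⟨(-(N / g) * (F / (g ^ N * v))) • fderiv ℝ (fun y : E ↦ ‖y - p‖ ^ a) x,
    HasDerivAt.comp_hasFDerivAt (h₂ := fun s : ℝ ↦ F / ((ε ^ a + s) ^ N * v))
      x hscalar hr.hasFDerivAt, ?_⟩
  rw [norm_smul, norm_mul, norm_neg, Real.norm_of_nonneg (by positivity),
    Real.norm_of_nonneg (by positivity)]
  calc N / g * (F / (g ^ N * v)) * ‖fderiv ℝ (fun y : E ↦ ‖y - p‖ ^ a) x‖
      ≤ N / g * (F / (g ^ N * v)) * (a * (g / max ‖x - p‖ ε)) := by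
        gcongr
        exact hrn.trans (by gcongr; exact rpow_sub_one_le_div_max ha (norm_nonneg _) hε)
    _ = _ := by field_simp

lemma exists_hasFDerivAt_log_sum {ι E : Type*} [Fintype ι] [NormedAddCommGroup E]
    [NormedSpace ℝ E] {u : ι → E → ℝ} {t : ι → ℝ} {x : E} {D : ℝ} (ht : ∀ i, 0 ≤ t i)
    (hu : ∀ i, ∃ L : E →L[ℝ] ℝ, HasFDerivAt (u i) L x ∧ ‖L‖ ≤ D * u i x)
    (hpos : 0 < ∑ i, t i * u i x) :
    ∃ L : E →L[ℝ] ℝ, HasFDerivAt (fun y ↦ Real.log (∑ i, t i * u i y)) L x ∧ ‖L‖ ≤ D := by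
  choose L hL hLn using hu
  have hS : HasFDerivAt (fun y ↦ ∑ i, t i * u i y) (∑ i, t i • L i) x :=
    HasFDerivAt.fun_sum fun i _ ↦ (hL i).const_mul (t i)
  refine ⟨_, hS.log hpos.ne', ?_⟩
  rw [norm_smul, norm_inv, Real.norm_of_nonneg hpos.le, inv_mul_le_iff₀ hpos]
  calc ‖∑ i, t i • L i‖ ≤ ∑ i, ‖t i • L i‖ := norm_sum_le _ _
    _ ≤ ∑ i, D * (t i * u i x) := by
        refine Finset.sum_le_sum fun i _ ↦ ?_
        rw [norm_smul, Real.norm_of_nonneg (ht i)]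
        calc t i * ‖L i‖ ≤ t i * (D * u i x) := by gcongr; exacts [ht i, hLn i]
          _ = _ := by ring
    _ = _ := by rw [← Finset.mul_sum, mul_comm]

lemma norm_gradient {E : Type*} [NormedAddCommGroup E] [InnerProductSpace ℝ E] [CompleteSpace E]
    (f : E → ℝ) (x : E) : ‖gradient f x‖ = ‖fderiv ℝ f x‖ := by
  simp [gradient]

lemma intervalIntegral_pow_mul_max_pow_inv {N : ℕ} (hN : N ≠ 0) {ε R : ℝ} (hε : 0 < ε)
    (hR : ε ≤ R) :
    ∫ y in (0 : ℝ)..R, y ^ (N - 1) * (max y ε ^ N)⁻¹ = 1 / N + Real.log (R / ε) := by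
  obtain ⟨k, rfl⟩ : ∃ k, N = k + 1 := ⟨N - 1, by omega⟩
  have hm : ∀ y : ℝ, 0 < max y ε := fun y ↦ lt_max_of_lt_right hε
  have hc : Continuous fun y : ℝ ↦ y ^ (k + 1 - 1) * (max y ε ^ (k + 1))⁻¹ := by
    refine (continuous_pow _).mul (Continuous.inv₀ (by fun_prop) fun y ↦ ?_)
    have := hm y
    positivity
  rw [← intervalIntegral.integral_add_adjacent_intervals
    (hc.intervalIntegrable 0 ε) (hc.intervalIntegrable ε R)]
  congr 1
  · calc _ = ∫ y in (0 : ℝ)..ε, y ^ k * (ε ^ (k + 1))⁻¹ := by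
          refine intervalIntegral.integral_congr fun y hy ↦ ?_
          rw [uIcc_of_le hε.le] at hy
          simp [max_eq_right hy.2]
      _ = _ := by
          rw [intervalIntegral.integral_mul_const, integral_pow]
          push_cast
          field_simp
          simp
  · rw [← integral_inv_of_pos hε (hε.trans_le hR)]
    refine intervalIntegral.integral_congr fun y hy ↦ ?_
    rw [uIcc_of_le hR] at hy
    have hy0 : 0 < y := hε.trans_le hy.1
    simp only [max_eq_left hy.1, Nat.add_sub_cancel]
    field_simp
    ring

lemma integrableOn_ball_max_norm_pow_inv {E : Type*} [NormedAddCommGroup E] [ProperSpace E]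
    [MeasurableSpace E] [BorelSpace E] (μ : Measure E) [IsFiniteMeasureOnCompacts μ] (N : ℕ)
    {ε : ℝ} (hε : 0 < ε) (p : E) (R : ℝ) :
    IntegrableOn (fun x : E ↦ (max ‖x - p‖ ε ^ N)⁻¹) (ball p R) μ := by
  have hc : Continuous fun x : E ↦ (max ‖x - p‖ ε ^ N)⁻¹ := by
    refine Continuous.inv₀ (by fun_prop) fun x ↦ ?_
    have : 0 < max ‖x - p‖ ε := lt_max_of_lt_right hε
    positivity
  exact (hc.continuousOn.integrableOn_compact (isCompact_closedBall p R)).mono_set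
    ball_subset_closedBall

lemma setIntegral_ball_max_norm_pow_inv {E : Type*} [NormedAddCommGroup E] [NormedSpace ℝ E]
    [FiniteDimensional ℝ E] [Nontrivial E] [MeasurableSpace E] [BorelSpace E] (μ : Measure E)
    [μ.IsAddHaarMeasure] {ε R : ℝ} (hε : 0 < ε) (hR : ε ≤ R) (p : E) :
    ∫ x in ball p R, (max ‖x - p‖ ε ^ Module.finrank ℝ E)⁻¹ ∂μ =
      Module.finrank ℝ E * μ.real (ball 0 1) *
        (1 / Module.finrank ℝ E + Real.log (R / ε)) := by
  set N := Module.finrank ℝ E with hNdef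
  have hN : N ≠ 0 := Module.finrank_pos.ne'
  set f : ℝ → ℝ := (Iio R).indicator fun r ↦ (max r ε ^ N)⁻¹ with hf
  have h1 : ∫ x in ball p R, (max ‖x - p‖ ε ^ N)⁻¹ ∂μ = ∫ x, f ‖x - p‖ ∂μ := by
    rw [← integral_indicator measurableSet_ball]
    refine integral_congr_ae (Filter.Eventually.of_forall fun x ↦ ?_)
    simp only [hf, indicator, mem_ball, dist_eq_norm, mem_Iio]
  rw [h1, integral_sub_right_eq_self (fun x ↦ f ‖x‖) p, integral_fun_norm_addHaar, ← hNdef]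
  have h2 : ∫ y in Ioi (0 : ℝ), y ^ (N - 1) • f y = 1 / N + Real.log (R / ε) := by
    have : (fun y : ℝ ↦ y ^ (N - 1) • f y) =
        (Iio R).indicator fun y ↦ y ^ (N - 1) * (max y ε ^ N)⁻¹ := by
      ext y
      by_cases h : y < R <;> simp [hf, h]
    rw [this, setIntegral_indicator measurableSet_Iio, Ioi_inter_Iio,
      ← integral_Ioc_eq_integral_Ioo, ← intervalIntegral.integral_of_le (hε.le.trans hR),
      intervalIntegral_pow_mul_max_pow_inv hN hε hR]
  rw [h2]
  simp only [nsmul_eq_mul, smul_eq_mul]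
  ring

lemma le_sum_mul_of_sum_eq_one {ι : Type*} [Fintype ι] {t u : ι → ℝ} {s : ℝ}
    (ht : ∀ i, 0 ≤ t i) (ht1 : ∑ i, t i = 1) (h : ∀ i, s ≤ u i) : s ≤ ∑ i, t i * u i := by
  calc s = ∑ i, t i * s := by rw [← Finset.sum_mul, ht1, one_mul]
    _ ≤ _ := Finset.sum_le_sum fun i _ ↦ mul_le_mul_of_nonneg_left (h i) (ht i)

lemma sum_mul_le_of_sum_eq_one {ι : Type*} [Fintype ι] {t u : ι → ℝ} {s : ℝ}
    (ht : ∀ i, 0 ≤ t i) (ht1 : ∑ i, t i = 1) (h : ∀ i, u i ≤ s) : ∑ i, t i * u i ≤ s := by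
  calc ∑ i, t i * u i ≤ ∑ i, t i * s :=
        Finset.sum_le_sum fun i _ ↦ mul_le_mul_of_nonneg_left (h i) (ht i)
    _ = s := by rw [← Finset.sum_mul, ht1, one_mul]

lemma sum_mul_pos_of_sum_eq_one {ι : Type*} [Fintype ι] {t u : ι → ℝ}
    (ht : ∀ i, 0 ≤ t i) (ht1 : ∑ i, t i = 1) (h : ∀ i, 0 < u i) : 0 < ∑ i, t i * u i := by
  obtain ⟨i, -, hi⟩ : ∃ i ∈ Finset.univ, 0 < t i := by
    by_contra! hcon
    linarith [Finset.sum_nonpos hcon]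
  exact Finset.sum_pos' (fun j _ ↦ mul_nonneg (ht j) (h j).le)
    ⟨i, Finset.mem_univ i, mul_pos hi (h i)⟩

lemma le_bubble {E : Type*} [NormedAddCommGroup E] {N : ℕ} (hN : 2 ≤ N) {F ε v C r s : ℝ}
    {p x : E} (hF : 0 < F) (hε : 0 < ε) (hεs : ε ≤ s) (hv : 0 < v) (hvC : v ≤ C)
    (hx : ‖x - p‖ ≤ r) :
    F / ((s ^ ((N : ℝ) / ((N : ℝ) - 1)) + r ^ ((N : ℝ) / ((N : ℝ) - 1))) ^ N * C) ≤
      bubble N F ε v p x := by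
  have ha := one_lt_div_sub_one hN
  have hs : 0 < s := hε.trans_le hεs
  have hr : 0 ≤ r := (norm_nonneg _).trans hx
  have hC : 0 < C := hv.trans_le hvC
  unfold bubble
  gcongr

lemma bubble_le {E : Type*} [NormedAddCommGroup E] {N : ℕ} (hN : 2 ≤ N) {F ε v c d : ℝ}
    {p x : E} (hF : 0 < F) (hε : 0 < ε) (hc : 0 < c) (hcv : c ≤ v) (hd : 0 < d)
    (hx : d ≤ ‖x - p‖) :
    bubble N F ε v p x ≤ F / ((d ^ ((N : ℝ) / ((N : ℝ) - 1))) ^ N * c) := by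
  have ha := one_lt_div_sub_one hN
  unfold bubble
  have h1 : d ^ ((N : ℝ) / ((N : ℝ) - 1)) ≤
      ε ^ ((N : ℝ) / ((N : ℝ) - 1)) + ‖x - p‖ ^ ((N : ℝ) / ((N : ℝ) - 1)) :=
    (rpow_le_rpow hd.le hx (by linarith)).trans (le_add_of_nonneg_left (by positivity))
  gcongr

lemma FN_pos {N : ℕ} (hN : 2 ≤ N) : 0 < FN N := by
  have h : (2 : ℝ) ≤ N := by exact_mod_cast hN
  have : (0 : ℝ) < (N : ℝ) - 1 := by linarith
  unfold FN; positivity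

lemma omegaN_pos (N : ℕ) : 0 < omegaN N :=
  ENNReal.toReal_pos (measure_ball_pos _ _ one_pos).ne' measure_ball_lt_top.ne

section TestFunction

variable {N m : ℕ} {χ V : EuclideanSpace ℝ (Fin N) → ℝ}
  {p : Fin m → EuclideanSpace ℝ (Fin N)} {t : Fin m → ℝ} {ε : ℝ}

lemma testFun_eq (x : EuclideanSpace ℝ (Fin N)) :
    testFun N m χ V p t ε x =
      χ x * Real.log (∑ i, t i * bubble N (FN N) ε (V (p i)) (p i) x) := rfl

lemma exists_hasFDerivAt_log_sum_bubble (hN : 2 ≤ N) (ht : ∀ i, 0 ≤ t i)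
    (ht1 : ∑ i, t i = 1) (hV : ∀ i, 0 < V (p i)) (hε : 0 < ε)
    {x : EuclideanSpace ℝ (Fin N)} {d : ℝ} (hd : 0 < d) (hdx : ∀ i, d ≤ max ‖x - p i‖ ε) :
    ∃ L : EuclideanSpace ℝ (Fin N) →L[ℝ] ℝ,
      HasFDerivAt (fun y ↦ Real.log (∑ i, t i * bubble N (FN N) ε (V (p i)) (p i) y)) L x ∧
        ‖L‖ ≤ (N : ℝ) ^ 2 / ((N : ℝ) - 1) / d := by
  have h : (2 : ℝ) ≤ N := by exact_mod_cast hN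
  have hN1 : (0 : ℝ) < (N : ℝ) - 1 := by linarith
  have hF := FN_pos hN
  refine exists_hasFDerivAt_log_sum (D := (N : ℝ) ^ 2 / ((N : ℝ) - 1) / d) ht (fun i ↦ ?_)
    (sum_mul_pos_of_sum_eq_one ht ht1 fun i ↦ bubble_pos N hF hε (hV i) _ _)
  obtain ⟨L, hL, hLn⟩ := exists_hasFDerivAt_bubble hN hF hε (hV i) (p i) x
  refine ⟨L, hL, hLn.trans ?_⟩
  have hb := (bubble_pos N hF hε (hV i) (p i) x).le
  have := hdx i
  gcongr

lemma continuous_testFun (hN : 2 ≤ N) (hχ : Continuous χ) (ht : ∀ i, 0 ≤ t i)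
    (ht1 : ∑ i, t i = 1) (hV : ∀ i, 0 < V (p i)) (hε : 0 < ε) :
    Continuous (testFun N m χ V p t ε) := by
  refine hχ.mul (continuous_iff_continuousAt.2 fun x ↦ ?_)
  obtain ⟨L, hL, -⟩ := exists_hasFDerivAt_log_sum_bubble hN ht ht1 hV hε (x := x) hε
    fun i ↦ le_max_right _ _
  exact hL.continuousAt

lemma norm_gradient_testFun_pow_le_of_eventuallyEq_one (hN : 2 ≤ N) (hm : 1 ≤ m)
    (ht : ∀ i, 0 ≤ t i) (ht1 : ∑ i, t i = 1) (hV : ∀ i, 0 < V (p i)) (hε : 0 < ε)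
    {x : EuclideanSpace ℝ (Fin N)} (hχ : χ =ᶠ[nhds x] fun _ ↦ 1) :
    ‖gradient (testFun N m χ V p t ε) x‖ ^ N ≤
      ((N : ℝ) ^ 2 / ((N : ℝ) - 1)) ^ N * ∑ i, (max ‖x - p i‖ ε ^ N)⁻¹ := by
  have h : (2 : ℝ) ≤ N := by exact_mod_cast hN
  have hN1 : (0 : ℝ) < (N : ℝ) - 1 := by linarith
  have : Nonempty (Fin m) := ⟨⟨0, hm⟩⟩
  have hmax : ∀ i, 0 < max ‖x - p i‖ ε := fun i ↦ lt_max_of_lt_right hε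
  obtain ⟨j, hj⟩ := Finite.exists_min fun i ↦ max ‖x - p i‖ ε
  obtain ⟨L, hL, hLn⟩ := exists_hasFDerivAt_log_sum_bubble hN ht ht1 hV hε (hmax j) hj
  have hL' : HasFDerivAt (testFun N m χ V p t ε) L x := by
    refine hL.congr_of_eventuallyEq ?_
    filter_upwards [hχ] with y hy
    rw [testFun_eq, hy, one_mul]
  rw [norm_gradient, hL'.fderiv]
  calc ‖L‖ ^ N ≤ ((N : ℝ) ^ 2 / ((N : ℝ) - 1) / max ‖x - p j‖ ε) ^ N := by gcongr
    _ = ((N : ℝ) ^ 2 / ((N : ℝ) - 1)) ^ N * (max ‖x - p j‖ ε ^ N)⁻¹ := by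
        rw [div_pow, div_eq_mul_inv]
    _ ≤ _ := by
        gcongr
        exact Finset.single_le_sum (f := fun i ↦ (max ‖x - p i‖ ε ^ N)⁻¹)
          (fun i _ ↦ by have := hmax i; positivity) (Finset.mem_univ j)

lemma norm_gradient_testFun_le_of_abs_log_le (hN : 2 ≤ N) (ht : ∀ i, 0 ≤ t i)
    (ht1 : ∑ i, t i = 1) (hV : ∀ i, 0 < V (p i)) (hε : 0 < ε)
    {x : EuclideanSpace ℝ (Fin N)} {d B l : ℝ} (hd : 0 < d) (hdx : ∀ i, d ≤ ‖x - p i‖)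
    (hχd : DifferentiableAt ℝ χ x) (hχ : |χ x| ≤ 1) (hB : ‖fderiv ℝ χ x‖ ≤ B)
    (hl : |Real.log (∑ i, t i * bubble N (FN N) ε (V (p i)) (p i) x)| ≤ l) :
    ‖gradient (testFun N m χ V p t ε) x‖ ≤ (N : ℝ) ^ 2 / ((N : ℝ) - 1) / d + l * B := by
  obtain ⟨L, hL, hLn⟩ := exists_hasFDerivAt_log_sum_bubble hN ht ht1 hV hε hd
    fun i ↦ (hdx i).trans (le_max_left _ _)
  have hL' : HasFDerivAt (testFun N m χ V p t ε) _ x := hχd.hasFDerivAt.mul hL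
  rw [norm_gradient, hL'.fderiv]
  have hl0 : 0 ≤ l := (abs_nonneg _).trans hl
  refine (norm_add_le _ _).trans (add_le_add ?_ ?_)
  · rw [norm_smul, Real.norm_eq_abs]
    exact (mul_le_of_le_one_left (norm_nonneg _) hχ).trans hLn
  · rw [norm_smul, Real.norm_eq_abs]
    exact mul_le_mul hl hB (norm_nonneg _) hl0

lemma le_setIntegral_mul_exp_testFun (hN : 2 ≤ N) {Ω : Set (EuclideanSpace ℝ (Fin N))}
    (hΩo : IsOpen Ω) (hΩb : Bornology.IsBounded Ω) (hm : 1 ≤ m) (hχ : Continuous χ)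
    (hVc : Continuous V) {C : ℝ} (hC : 0 < C) (hV : ∀ x ∈ Ω, 1 / C ≤ V x ∧ V x ≤ C)
    (ht : ∀ i, 0 ≤ t i) (ht1 : ∑ i, t i = 1) (hp : ∀ i, p i ∈ Ω) (hε : 0 < ε)
    (hball : ∀ i, ∀ x ∈ ball (p i) ε, x ∈ Ω ∧ χ x = 1) :
    (ε ^ N * omegaN N) * (1 / C * (1 / m *
      (FN N / ((2 * ε ^ ((N : ℝ) / ((N : ℝ) - 1))) ^ N * C)))) ≤
      ∫ x in Ω, V x * Real.exp (testFun N m χ V p t ε x) := by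
  have hF := FN_pos hN
  have hVpos : ∀ x ∈ Ω, 0 < V x := fun x hx ↦ (by positivity : 0 < 1 / C).trans_le (hV x hx).1
  have hVp : ∀ i, 0 < V (p i) := fun i ↦ hVpos _ (hp i)
  have hm0 : (0 : ℝ) < m := by exact_mod_cast hm
  have hcont : Continuous fun x ↦ V x * Real.exp (testFun N m χ V p t ε x) :=
    hVc.mul (Real.continuous_exp.comp (continuous_testFun hN hχ ht ht1 hVp hε))
  have hint : IntegrableOn (fun x ↦ V x * Real.exp (testFun N m χ V p t ε x)) Ω :=
    (hcont.continuousOn.integrableOn_compact hΩb.isCompact_closure).mono_set subset_closure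
  have : Nonempty (Fin m) := ⟨⟨0, hm⟩⟩
  obtain ⟨j, -, hj⟩ : ∃ j ∈ Finset.univ, 1 / (m : ℝ) ≤ t j := by
    refine Finset.exists_le_of_sum_le Finset.univ_nonempty ?_
    rw [ht1, Finset.sum_const, Finset.card_univ, Fintype.card_fin, nsmul_eq_mul]
    field_simp
    exact le_rfl
  have hsub : ball (p j) ε ⊆ Ω := fun x hx ↦ (hball j x hx).1
  have hmono : ∫ x in ball (p j) ε, V x * Real.exp (testFun N m χ V p t ε x) ≤
      ∫ x in Ω, V x * Real.exp (testFun N m χ V p t ε x) := by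
    refine setIntegral_mono_set hint ?_ hsub.eventuallyLE
    filter_upwards [ae_restrict_mem hΩo.measurableSet] with x hx
    exact mul_nonneg (hVpos x hx).le (Real.exp_nonneg _)
  refine le_trans ?_ hmono
  have hvol : volume.real (ball (p j) ε) = ε ^ N * omegaN N := by
    rw [measureReal_def, Measure.addHaar_ball_of_pos _ _ hε, finrank_euclideanSpace_fin,
      ENNReal.toReal_mul, ENNReal.toReal_ofReal (by positivity)]
    rfl
  rw [← hvol, ← smul_eq_mul, ← setIntegral_const]
  refine setIntegral_mono_on (integrableOn_const measure_ball_lt_top.ne)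
    (hint.mono_set hsub) measurableSet_ball fun x hx ↦ ?_
  have hS : ∀ i, 0 < bubble N (FN N) ε (V (p i)) (p i) x :=
    fun i ↦ bubble_pos N hF hε (hVp i) _ _
  rw [testFun_eq, (hball j x hx).2, one_mul, Real.exp_log (sum_mul_pos_of_sum_eq_one ht ht1 hS)]
  have hb : FN N / ((2 * ε ^ ((N : ℝ) / ((N : ℝ) - 1))) ^ N * C) ≤
      bubble N (FN N) ε (V (p j)) (p j) x := by
    rw [two_mul]
    exact le_bubble hN hF hε le_rfl (hVp j) (hV _ (hp j)).2 (mem_ball_iff_norm.1 hx).le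
  have hsum : 1 / (m : ℝ) * (FN N / ((2 * ε ^ ((N : ℝ) / ((N : ℝ) - 1))) ^ N * C)) ≤
      ∑ i, t i * bubble N (FN N) ε (V (p i)) (p i) x := by
    refine le_trans (mul_le_mul hj hb (by positivity) (ht j)) ?_
    exact Finset.single_le_sum (f := fun i ↦ t i * bubble N (FN N) ε (V (p i)) (p i) x)
      (fun i _ ↦ mul_nonneg (ht i) (hS i).le) (Finset.mem_univ j)
  have hx' := hsub hx
  exact mul_le_mul (hV x hx').1 hsum (by positivity) (hVpos x hx').le

lemma setIntegral_norm_gradient_testFun_pow_le (hN : 2 ≤ N)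
    {Ω : Set (EuclideanSpace ℝ (Fin N))} (hΩo : IsOpen Ω) (hΩb : Bornology.IsBounded Ω)
    (hp : ∀ i, p i ∈ Ω) {A R : ℝ} (hε : 0 < ε) (hεR : ε ≤ R)
    (hR : ∀ x ∈ Ω, ∀ y ∈ Ω, dist x y < R)
    (hbound : ∀ x ∈ Ω, ‖gradient (testFun N m χ V p t ε) x‖ ^ N ≤
      A + ((N : ℝ) ^ 2 / ((N : ℝ) - 1)) ^ N * ∑ i, (max ‖x - p i‖ ε ^ N)⁻¹) :
    ∫ x in Ω, ‖gradient (testFun N m χ V p t ε) x‖ ^ N ≤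
      A * volume.real Ω + ((N : ℝ) ^ 2 / ((N : ℝ) - 1)) ^ N *
        (m * (N * omegaN N * (1 / N + Real.log (R / ε)))) := by
  have h2 : (2 : ℝ) ≤ N := by exact_mod_cast hN
  have hN1 : (0 : ℝ) < (N : ℝ) - 1 := by linarith
  have hsub : ∀ i, Ω ⊆ ball (p i) R := fun i x hx ↦ hR x hx _ (hp i)
  have hballint : ∀ i, IntegrableOn (fun x ↦ (max ‖x - p i‖ ε ^ N)⁻¹) (ball (p i) R) :=
    fun i ↦ integrableOn_ball_max_norm_pow_inv _ N hε (p i) R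
  have hint : ∀ i, IntegrableOn (fun x ↦ (max ‖x - p i‖ ε ^ N)⁻¹) Ω :=
    fun i ↦ (hballint i).mono_set (hsub i)
  have hcint : IntegrableOn (fun _ ↦ A) Ω := integrableOn_const hΩb.measure_lt_top.ne
  have hsint : IntegrableOn (fun x ↦ ((N : ℝ) ^ 2 / ((N : ℝ) - 1)) ^ N *
      ∑ i, (max ‖x - p i‖ ε ^ N)⁻¹) Ω :=
    (integrable_finsetSum _ fun i _ ↦ hint i).const_mul _
  have hstep : ∫ x in Ω, ‖gradient (testFun N m χ V p t ε) x‖ ^ N ≤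
      ∫ x in Ω, (A + ((N : ℝ) ^ 2 / ((N : ℝ) - 1)) ^ N * ∑ i, (max ‖x - p i‖ ε ^ N)⁻¹) := by
    refine integral_mono_of_nonneg (Filter.Eventually.of_forall fun x ↦ by positivity)
      (hcint.add hsint) ?_
    filter_upwards [ae_restrict_mem hΩo.measurableSet] with x hx using hbound x hx
  refine hstep.trans ?_
  rw [integral_add hcint hsint, setIntegral_const, smul_eq_mul, mul_comm (volume.real Ω),
    integral_const_mul, integral_finsetSum _ fun i _ ↦ hint i]
  gcongr
  have : ∀ i ∈ Finset.univ, ∫ x in Ω, (max ‖x - p i‖ ε ^ N)⁻¹ ≤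
      N * omegaN N * (1 / N + Real.log (R / ε)) := fun i _ ↦ by
    have : Nonempty (Fin N) := ⟨⟨0, by omega⟩⟩
    have h := setIntegral_ball_max_norm_pow_inv
      (volume : Measure (EuclideanSpace ℝ (Fin N))) hε hεR (p i)
    rw [finrank_euclideanSpace_fin] at h
    refine (setIntegral_mono_set (hballint i) (Filter.Eventually.of_forall fun x ↦ ?_)
      (hsub i).eventuallyLE).trans h.le
    have : 0 < max ‖x - p i‖ ε := lt_max_of_lt_right hε
    positivity
  refine (Finset.sum_le_sum this).trans ?_
  simp

end TestFunction

/-- The mean field functional tends to `−∞` along the test functions, uniformly in `σ`. -/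
theorem bubble_energy_to_neg_infinity (N : ℕ) (hN : 2 ≤ N)
    (Ω : Set (EuclideanSpace ℝ (Fin N))) (hΩo : IsOpen Ω) (hΩb : Bornology.IsBounded Ω)
    (δ : ℝ) (hδ : 0 < δ)
    (χ : EuclideanSpace ℝ (Fin N) → ℝ) (hχsm : ContDiff ℝ (⊤ : ℕ∞) χ)
    (hχc : HasCompactSupport χ) (hχΩ : tsupport χ ⊆ Ω)
    (hχ01 : ∀ x, 0 ≤ χ x ∧ χ x ≤ 1)
    (hχ1 : ∀ x ∈ Ω, δ / 2 < Metric.infDist x Ωᶜ → χ x = 1)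
    (hK : ∃ x ∈ Ω, δ ≤ Metric.infDist x Ωᶜ)
    (C₀ : ℝ) (hC₀ : 1 ≤ C₀) (V : EuclideanSpace ℝ (Fin N) → ℝ)
    (hVlip : LipschitzWith (Real.toNNReal C₀) V)
    (hV : ∀ x ∈ closure Ω, 1 / C₀ ≤ V x ∧ V x ≤ C₀)
    (m : ℕ) (hm : 1 ≤ m)
    (lam : ℝ) (hlam : cN N * m < lam) :
    ∀ M : ℝ, 0 < M →
      ∃ ε₁ : ℝ, 0 < ε₁ ∧
        ∀ ε : ℝ, 0 < ε → ε ≤ ε₁ →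
        ∀ (p : Fin m → EuclideanSpace ℝ (Fin N)) (t : Fin m → ℝ),
          (∀ i, p i ∈ Ω ∧ δ ≤ Metric.infDist (p i) Ωᶜ) →
          (∀ i, 0 ≤ t i) → (∑ i, t i) = 1 →
          (1 / (N : ℝ)) * (∫ x in Ω, ‖gradient (testFun N m χ V p t ε) x‖ ^ N) -
              lam * Real.log (∫ x in Ω, V x * Real.exp (testFun N m χ V p t ε x)) ≤ -M := by
  intro M hM
  have h2 : (2 : ℝ) ≤ N := by exact_mod_cast hN
  have hN1 : (0 : ℝ) < (N : ℝ) - 1 := by linarith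
  have hF := FN_pos hN
  have hω := omegaN_pos N
  have hm0 : (0 : ℝ) < m := by exact_mod_cast hm
  have hC : 0 < C₀ := by linarith
  have hlam0 : 0 < lam := lt_of_le_of_lt (by unfold cN; positivity) hlam
  have hVΩ : ∀ x ∈ Ω, 1 / C₀ ≤ V x ∧ V x ≤ C₀ := fun x hx ↦ hV x (subset_closure hx)
  have ha := one_lt_div_sub_one hN
  have ha0 : 0 < (N : ℝ) / ((N : ℝ) - 1) := by linarith
  have hχdiff : Differentiable ℝ χ := hχsm.differentiable (by simp)
  obtain ⟨B, hB⟩ := (hχc.fderiv (𝕜 := ℝ)).exists_bound_of_continuous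
    (hχsm.continuous_fderiv (by simp))
  have hB0 : 0 ≤ B := (norm_nonneg _).trans (hB 0)
  set R : ℝ := diam Ω + 1
  have hR1 : 1 ≤ R := le_add_of_nonneg_left diam_nonneg
  have hR : ∀ x ∈ Ω, ∀ y ∈ Ω, dist x y < R := fun x hx y hy ↦
    (dist_le_diam_of_mem hΩb hx hy).trans_lt (lt_add_one _)
  set s₁ : ℝ := FN N / ((1 ^ ((N : ℝ) / ((N : ℝ) - 1)) + R ^ ((N : ℝ) / ((N : ℝ) - 1))) ^ N * C₀)
  set s₂ : ℝ := FN N / (((δ / 2) ^ ((N : ℝ) / ((N : ℝ) - 1))) ^ N * (1 / C₀))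
  have hs₁ : 0 < s₁ := by positivity
  set l : ℝ := max |Real.log s₁| |Real.log s₂|
  have hl0 : 0 ≤ l := le_max_of_le_left (abs_nonneg _)
  set A : ℝ := ((N : ℝ) ^ 2 / ((N : ℝ) - 1) / (δ / 2) + l * B) ^ N
  have hA : 0 ≤ A := by positivity
  set c₀ : ℝ := omegaN N * (1 / C₀ * (1 / m * (FN N / (2 ^ N * C₀))))
  have hc₀ : 0 < c₀ := by positivity
  set E : ℝ := A * volume.real Ω / N +
    m * (((N : ℝ) ^ 2 / ((N : ℝ) - 1)) ^ N * omegaN N) * (1 / N + Real.log R) -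
      lam * Real.log c₀
  set Q : ℝ := (E + M) / ((lam - cN N * m) * ((N : ℝ) / ((N : ℝ) - 1)))
  have hgap : 0 < lam - cN N * m := sub_pos.2 hlam
  refine ⟨min (min 1 (δ / 4)) (Real.exp (-Q)), by positivity, ?_⟩
  intro ε hε hε₁ p t hp ht ht1
  have hεone : ε ≤ 1 := hε₁.trans ((min_le_left _ _).trans (min_le_left _ _))
  have hεδ : ε ≤ δ / 4 := hε₁.trans ((min_le_left _ _).trans (min_le_right _ _))
  have hεQ : Q ≤ -Real.log ε := by
    have := (Real.log_le_iff_le_exp hε).2 (hε₁.trans (min_le_right _ _))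
    linarith
  have hVp : ∀ i, 0 < V (p i) := fun i ↦
    (by positivity : 0 < 1 / C₀).trans_le (hVΩ _ (hp i).1).1
  have hgrad : ∀ x ∈ Ω, ‖gradient (testFun N m χ V p t ε) x‖ ^ N ≤
      A + ((N : ℝ) ^ 2 / ((N : ℝ) - 1)) ^ N * ∑ i, (max ‖x - p i‖ ε ^ N)⁻¹ := by
    intro x hx
    by_cases hxδ : δ / 2 < infDist x Ωᶜ
    · refine (norm_gradient_testFun_pow_le_of_eventuallyEq_one hN hm ht ht1 hVp hε ?_).trans
        (le_add_of_nonneg_left hA)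
      filter_upwards [hΩo.mem_nhds hx,
        (continuous_infDist_pt Ωᶜ).continuousAt.eventually_const_lt hxδ] with y hy hyδ
      exact hχ1 y hy hyδ
    · push Not at hxδ
      have hdist : ∀ i, δ / 2 ≤ ‖x - p i‖ := fun i ↦ by
        have := infDist_le_infDist_add_dist (s := Ωᶜ) (x := p i) (y := x)
        rw [← dist_eq_norm, dist_comm]
        linarith [(hp i).2]
      have hle : s₁ ≤ ∑ i, t i * bubble N (FN N) ε (V (p i)) (p i) x :=
        le_sum_mul_of_sum_eq_one ht ht1 fun i ↦ le_bubble hN hF hε hεone (hVp i)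
          (hVΩ _ (hp i).1).2 (by rw [← dist_eq_norm]; exact (hR x hx _ (hp i).1).le)
      have hge : ∑ i, t i * bubble N (FN N) ε (V (p i)) (p i) x ≤ s₂ :=
        sum_mul_le_of_sum_eq_one ht ht1 fun i ↦ bubble_le hN hF hε (by positivity)
          (hVΩ _ (hp i).1).1 (by positivity) (hdist i)
      have hlog := abs_le_max_abs_abs (Real.log_le_log hs₁ hle)
        (Real.log_le_log (hs₁.trans_le hle) hge)
      refine le_add_of_le_of_nonneg (pow_le_pow_left₀ (norm_nonneg _)
        (norm_gradient_testFun_le_of_abs_log_le hN ht ht1 hVp hε (by positivity) hdist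
          (hχdiff x) ?_ (hB x) hlog) N) ?_
      · rw [abs_of_nonneg (hχ01 x).1]
        exact (hχ01 x).2
      · have : ∀ i, 0 < max ‖x - p i‖ ε := fun i ↦ lt_max_of_lt_right hε
        have : 0 ≤ ∑ i, (max ‖x - p i‖ ε ^ N)⁻¹ :=
          Finset.sum_nonneg fun i _ ↦ by have := this i; positivity
        positivity
  have hball : ∀ i, ∀ x ∈ ball (p i) ε, x ∈ Ω ∧ χ x = 1 := by
    intro i x hx
    have hx' : dist (p i) x < ε := by rw [dist_comm]; exact hx
    have := infDist_le_infDist_add_dist (s := Ωᶜ) (x := p i) (y := x)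
    have hxδ : δ / 2 < infDist x Ωᶜ := by linarith [(hp i).2]
    have hxΩ : x ∈ Ω := by
      by_contra hcon
      rw [infDist_zero_of_mem (mem_compl hcon)] at hxδ
      linarith
    exact ⟨hxΩ, hχ1 x hxΩ hxδ⟩
  have hupper := setIntegral_norm_gradient_testFun_pow_le hN hΩo hΩb (fun i ↦ (hp i).1) hε
    (hεone.trans hR1) hR hgrad
  have hlower := le_setIntegral_mul_exp_testFun hN hΩo hΩb hm hχsm.continuous
    hVlip.continuous hC hVΩ ht ht1 (fun i ↦ (hp i).1) hε hball
  have hscale : (ε ^ N * omegaN N) * (1 / C₀ * (1 / m *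
      (FN N / ((2 * ε ^ ((N : ℝ) / ((N : ℝ) - 1))) ^ N * C₀)))) =
      c₀ * ε ^ (-((N : ℝ) / ((N : ℝ) - 1))) := by
    have : ε ^ N = (ε ^ ((N : ℝ) / ((N : ℝ) - 1))) ^ N * ε ^ (-((N : ℝ) / ((N : ℝ) - 1))) := by
      rw [← rpow_natCast ε N, ← rpow_mul_natCast hε.le, ← rpow_add hε]
      congr 1
      field_simp
      ring
    rw [this]
    simp only [c₀, mul_pow]
    field_simp
  rw [hscale] at hlower
  have hloglower := Real.log_le_log (by positivity) hlower
  rw [Real.log_mul hc₀.ne' (by positivity), Real.log_rpow hε] at hloglower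
  have hK : ((N : ℝ) ^ 2 / ((N : ℝ) - 1)) ^ N * omegaN N =
      cN N * ((N : ℝ) / ((N : ℝ) - 1)) := by
    obtain ⟨k, rfl⟩ : ∃ k, N = k + 1 := ⟨N - 1, by omega⟩
    unfold cN
    rw [pow_succ, Nat.add_sub_cancel]
    ring
  rw [Real.log_div (by positivity) hε.ne'] at hupper
  have hQ := (div_le_iff₀ (by positivity)).1 hεQ
  set I₁ := ∫ x in Ω, ‖gradient (testFun N m χ V p t ε) x‖ ^ N
  set I₂ := ∫ x in Ω, V x * Real.exp (testFun N m χ V p t ε x)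
  calc (1 / (N : ℝ)) * I₁ - lam * Real.log I₂
      ≤ (1 / (N : ℝ)) * (A * volume.real Ω + ((N : ℝ) ^ 2 / ((N : ℝ) - 1)) ^ N *
          (m * (N * omegaN N * (1 / N + (Real.log R - Real.log ε))))) -
        lam * (Real.log c₀ + -((N : ℝ) / ((N : ℝ) - 1)) * Real.log ε) := by gcongr
    _ = A * volume.real Ω / N + m * (((N : ℝ) ^ 2 / ((N : ℝ) - 1)) ^ N * omegaN N) *
          (1 / N + (Real.log R - Real.log ε)) -
        lam * (Real.log c₀ + -((N : ℝ) / ((N : ℝ) - 1)) * Real.log ε) := by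
      congr 1
      have : (N : ℝ) ≠ 0 := by linarith
      generalize ((N : ℝ) ^ 2 / ((N : ℝ) - 1)) ^ N = K
      field_simp
    _ = E - -Real.log ε * ((lam - cN N * m) * ((N : ℝ) / ((N : ℝ) - 1))) := by
      simp only [E, hK]
      ring
    _ ≤ -M := by linarith
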